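/- (Main Lemma.) Let f : {0,1}^n → {0,1} be monotone with I[f] ≥ 1, let ε ∈ (0, 1) satisfy ε > 8·√(2·log(8n/ε))/√n, and set ε̃ = ε/4. Let s* = (1/2)·√(2n·log(2n/ε̃)), and let w be a positive integer with w ≤ ε̃·√n / (16·√(2·log(2n/(ε̃·I[f])))). Let p_{w,s*}(f) denote the probability that a random walk of length w down the Boolean lattice with cutoff at level n/2 − s* − 1, from a uniform start, starts at a point v with f(v) = 1 and ends at a point u with f(u) = 0. Then (1 − ε)·(w/n)·I[f] ≤ p_{w,s*}(f) ≤ (1 + ε)·(w/n)·I[f]. -/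

import Mathlib

/-- Hamming weight of a point of the Boolean lattice `{0,1}^n`. -/
def hw {n : ℕ} (x : Fin n → Bool) : ℕ := (Finset.univ.filter (fun i => x i = true)).card

/-- `bflip x i` is `x` with its `i`-th coordinate flipped. -/
def bflip {n : ℕ} (x : Fin n → Bool) (i : Fin n) : Fin n → Bool :=
  Function.update x i (!x i)

/-- The position of the walk after `t` steps, when the walk starts at `v` and
successively flips to 0 the coordinates of `v` that equal 1, in the order given by the
linear ordering `σ` of these coordinates. -/
def walkPos {n : ℕ} (v : Fin n → Bool) (σ : Fin (hw v) ≃ {i : Fin n // v i = true})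
    (t : ℕ) : Fin n → Bool :=
  fun i => v i && ! decide (∃ s : Fin (hw v), (s : ℕ) < t ∧ (σ s).val = i)

/-- The number of steps performed by a random walk of length `w` down the Boolean
lattice with cutoff at level `c`, when started at `v`:
`min(w, max(0, h(v) − ⌈c⌉))`. -/
noncomputable def nsteps {n : ℕ} (w : ℕ) (c : ℝ) (v : Fin n → Bool) : ℕ :=
  min w ((hw v : ℤ) - ⌈c⌉).toNat

/-- The probability of an event `P` in the finite probability space of pairs `(v, σ)`,
where `v` is uniform in `{0,1}^n` and `σ` is an independent uniformly random linear
ordering of the coordinates on which `v` equals 1. -/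
noncomputable def walkProb {n : ℕ}
    (P : (v : Fin n → Bool) → (Fin (hw v) ≃ {i : Fin n // v i = true}) → Prop) : ℝ :=
  (2 ^ n : ℝ)⁻¹ * ∑ v : Fin n → Bool,
    (Nat.card {σ : Fin (hw v) ≃ {i : Fin n // v i = true} // P v σ} : ℝ) /
      (Nat.factorial (hw v))

/-- The walk `(v, σ)` (of length `w`, with cutoff at level `c`) traverses the edge
`(y, x)` if at some step it moves from the point `y` to the point `x`. -/
def traverses {n : ℕ} (w : ℕ) (c : ℝ) (y x : Fin n → Bool)
    (v : Fin n → Bool) (σ : Fin (hw v) ≃ {i : Fin n // v i = true}) : Prop :=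
  ∃ t : ℕ, t < nsteps w c v ∧ walkPos v σ t = y ∧ walkPos v σ (t + 1) = x

/-- The individual influence of coordinate `i` on `f`. -/
noncomputable def infl {n : ℕ} (f : (Fin n → Bool) → Bool) (i : Fin n) : ℝ :=
  ((Finset.univ.filter (fun x : Fin n → Bool => f x ≠ f (bflip x i))).card : ℝ) / 2 ^ n

/-- The total influence `I[f] = Σ_i I_i[f]`. -/
noncomputable def totalInfl {n : ℕ} (f : (Fin n → Bool) → Bool) : ℝ := ∑ i, infl f i

/-- `f` is monotone if `x ≤ y` coordinatewise implies `f(x) ≤ f(y)`. -/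
def MonotoneBF {n : ℕ} (f : (Fin n → Bool) → Bool) : Prop :=
  ∀ x y : Fin n → Bool, (∀ i, x i ≤ y i) → f x ≤ f y


open Finset

/-- the real valued version of a Boolean function -/
noncomputable def fR {n : ℕ} (f : (Fin n → Bool) → Bool) (x : Fin n → Bool) : ℝ :=
  if f x = true then 1 else 0

/-- sum of `F` over all points of level `k` -/
noncomputable def lev {n : ℕ} (F : (Fin n → Bool) → ℝ) (k : ℕ) : ℝ :=
  ∑ y ∈ univ.filter (fun y : Fin n → Bool => hw y = k), F y

/-- average of `F` over the points of level `k` -/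
noncomputable def mu {n : ℕ} (F : (Fin n → Bool) → ℝ) (k : ℕ) : ℝ := lev F k / (n.choose k : ℝ)

lemma hw_eq_card {n : ℕ} (v : Fin n → Bool) : hw v = Fintype.card {i : Fin n // v i = true} := by
  rw [Fintype.card_subtype]; rfl

lemma hw_le {n : ℕ} (v : Fin n → Bool) : hw v ≤ n := by
  unfold hw
  exact (card_le_univ _).trans (by simp)

lemma card_level (n k : ℕ) :
    (univ.filter (fun y : Fin n → Bool => hw y = k)).card = n.choose k := by
  have h := card_powersetCard k (univ : Finset (Fin n))
  rw [card_univ, Fintype.card_fin] at h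
  rw [← h]
  refine card_bij' (fun y _ => univ.filter (fun i => y i = true)) (fun S _ i => decide (i ∈ S))
    ?_ ?_ ?_ ?_
  · intro y hy
    simp only [mem_filter, mem_univ, true_and] at hy
    simp only [mem_powersetCard, subset_univ, true_and]
    exact hy
  · intro S hS
    simp only [mem_powersetCard, subset_univ, true_and] at hS
    rw [mem_filter]
    refine ⟨mem_univ _, ?_⟩
    simp [hw, hS]
  · intro y _
    ext i
    simp
  · intro S _
    ext i
    simp

lemma lev_eq {n : ℕ} (F : (Fin n → Bool) → ℝ) {k : ℕ} (hk : k ≤ n) :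
    lev F k = (n.choose k : ℝ) * mu F k := by
  have : (n.choose k : ℝ) ≠ 0 := by
    exact_mod_cast (Nat.choose_pos hk).ne'
  unfold mu
  field_simp

lemma hw_comp {n : ℕ} (v : Fin n → Bool) (π : Equiv.Perm (Fin n)) : hw (v ∘ π) = hw v := by
  rw [hw_eq_card, hw_eq_card]
  exact Fintype.card_congr (π.subtypeEquiv (fun a => by simp))

lemma exists_perm {n : ℕ} (y z : Fin n → Bool) (h : hw y = hw z) :
    ∃ π : Equiv.Perm (Fin n), y = z ∘ π := by
  rw [hw_eq_card, hw_eq_card] at h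
  let e := Fintype.equivOfCardEq h
  refine ⟨e.extendSubtype, ?_⟩
  ext i
  by_cases hi : y i = true
  · have := e.extendSubtype_mem i hi
    simp [hi, this]
  · have := e.extendSubtype_not_mem i hi
    simp only [Function.comp]
    simp only [Bool.not_eq_true] at hi this
    rw [hi, this]

lemma hw_walkPos {n : ℕ} (v : Fin n → Bool) (σ : Fin (hw v) ≃ {i : Fin n // v i = true})
    (t : ℕ) : hw (walkPos v σ t) = hw v - t := by
  have : (univ.filter (fun i => walkPos v σ t i = true)) =
      (univ.filter (fun s : Fin (hw v) => t ≤ (s : ℕ))).map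
        (σ.toEmbedding.trans (Function.Embedding.subtype _)) := by
    ext i
    simp only [walkPos, mem_filter, mem_univ, true_and, mem_map, Bool.and_eq_true,
      Bool.not_eq_true', decide_eq_false_iff_not, not_exists, not_and]
    constructor
    · rintro ⟨h1, h2⟩
      refine ⟨σ.symm ⟨i, h1⟩, ?_, by simp⟩
      by_contra hlt
      exact h2 (σ.symm ⟨i, h1⟩) (by omega) (by simp)
    · rintro ⟨s, hs, rfl⟩
      refine ⟨(σ s).2, fun s' hs' h => ?_⟩
      have := σ.injective (Subtype.ext h : σ s' = σ s)
      subst this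
      omega
  conv_lhs => unfold hw
  rw [this, card_map]
  have h2 : (univ.filter (fun s : Fin (hw v) => t ≤ (s : ℕ))).card = (Ico t (hw v)).card := by
    rw [← card_map Fin.valEmbedding]
    congr 1
    ext j
    simp only [mem_map, mem_filter, mem_univ, true_and, Fin.valEmbedding_apply, mem_Ico]
    constructor
    · rintro ⟨s, hs, rfl⟩
      exact ⟨hs, s.2⟩
    · rintro ⟨h1, h2⟩
      exact ⟨⟨j, h2⟩, h1, rfl⟩
  rw [h2, Nat.card_Ico]

lemma sum_sigma_comp {n : ℕ} (v : Fin n → Bool) (π : Equiv.Perm (Fin n)) (t : ℕ)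
    (Φ : (Fin n → Bool) → ℝ) :
    ∑ σ : Fin (hw (v ∘ π)) ≃ {i : Fin n // (v ∘ π) i = true}, Φ (walkPos (v ∘ π) σ t) =
      ∑ σ : Fin (hw v) ≃ {i : Fin n // v i = true}, Φ (walkPos v σ t ∘ π) := by
  let e : {i : Fin n // (v ∘ π) i = true} ≃ {i : Fin n // v i = true} :=
    π.subtypeEquiv (fun a => by simp)
  let E := Equiv.equivCongr (finCongr (hw_comp v π)) e
  refine Fintype.sum_equiv E _ _ (fun σ => ?_)
  congr 1
  ext i
  simp only [walkPos, Function.comp]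
  congr 2
  rw [decide_eq_decide]
  constructor
  · rintro ⟨s, hs, h⟩
    refine ⟨finCongr (hw_comp v π) s, by simpa using hs, ?_⟩
    simp [E, e, Equiv.equivCongr, ← h]
  · rintro ⟨s, hs, h⟩
    refine ⟨(finCongr (hw_comp v π)).symm s, by simpa using hs, ?_⟩
    apply π.injective
    rw [← h]
    simp [E, e, Equiv.equivCongr]

/-- number of walks from level `m` whose position at time `t` is `y` -/
noncomputable def cnt (n m t : ℕ) (y : Fin n → Bool) : ℝ :=
  ∑ v ∈ univ.filter (fun v : Fin n → Bool => hw v = m),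
    ∑ σ : Fin (hw v) ≃ {i : Fin n // v i = true}, if walkPos v σ t = y then 1 else 0

lemma cnt_comp (n m t : ℕ) (y : Fin n → Bool) (π : Equiv.Perm (Fin n)) :
    cnt n m t (y ∘ π) = cnt n m t y := by
  unfold cnt
  rw [sum_filter, sum_filter]
  symm
  refine Fintype.sum_equiv (Equiv.arrowCongr π.symm (Equiv.refl Bool)) _ _ (fun v => ?_)
  have : (Equiv.arrowCongr π.symm (Equiv.refl Bool)) v = v ∘ π := by
    ext i; simp
  rw [this, sum_sigma_comp v π t (fun z => if z = y ∘ π then 1 else 0), hw_comp]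
  have hh : ∀ z : Fin n → Bool, (z ∘ π = y ∘ π) = (z = y) := fun z =>
    propext (π.surjective.right_cancellable)
  simp only [hh]

lemma sum_walk_cnt (n m t : ℕ) (F : (Fin n → Bool) → ℝ) :
    ∑ v ∈ univ.filter (fun v : Fin n → Bool => hw v = m),
      ∑ σ : Fin (hw v) ≃ {i : Fin n // v i = true}, F (walkPos v σ t) =
    ∑ y ∈ univ.filter (fun y : Fin n → Bool => hw y = m - t), F y * cnt n m t y := by
  unfold cnt
  simp only [mul_sum]
  rw [sum_comm]
  refine sum_congr rfl fun v hv => ?_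
  simp only [mem_filter, mem_univ, true_and] at hv
  rw [sum_comm]
  refine sum_congr rfl fun σ _ => ?_
  have : walkPos v σ t ∈ univ.filter (fun y : Fin n → Bool => hw y = m - t) := by
    simp [hw_walkPos, hv]
  simp only [mul_ite, mul_one, mul_zero]
  rw [sum_ite_eq, if_pos this]

lemma card_walks {n : ℕ} (v : Fin n → Bool) :
    Fintype.card (Fin (hw v) ≃ {i : Fin n // v i = true}) = (hw v).factorial := by
  have e : Fin (hw v) ≃ {i : Fin n // v i = true} :=
    Fintype.equivOfCardEq (by rw [Fintype.card_fin, hw_eq_card])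
  rw [Fintype.card_equiv e, Fintype.card_fin]

lemma sum_walk (n m t : ℕ) (hm : m ≤ n) (F : (Fin n → Bool) → ℝ) :
    ∑ v ∈ univ.filter (fun v : Fin n → Bool => hw v = m),
      ∑ σ : Fin (hw v) ≃ {i : Fin n // v i = true}, F (walkPos v σ t) =
    (m.factorial : ℝ) * (n.choose m) * mu F (m - t) := by
  obtain ⟨y0, hy0⟩ : ∃ y0 : Fin n → Bool, hw y0 = m - t := by
    have h : 0 < (univ.filter (fun y : Fin n → Bool => hw y = m - t)).card := by
      rw [card_level]; exact Nat.choose_pos (by omega)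
    obtain ⟨y, hy⟩ := card_pos.1 h
    exact ⟨y, by simpa using hy⟩
  have key : ∀ G : (Fin n → Bool) → ℝ,
      ∑ v ∈ univ.filter (fun v : Fin n → Bool => hw v = m),
      ∑ σ : Fin (hw v) ≃ {i : Fin n // v i = true}, G (walkPos v σ t) =
      lev G (m - t) * cnt n m t y0 := by
    intro G
    rw [sum_walk_cnt, lev, sum_mul]
    refine sum_congr rfl fun y hy => ?_
    simp only [mem_filter, mem_univ, true_and] at hy
    obtain ⟨π, rfl⟩ := exists_perm y y0 (hy.trans hy0.symm)
    rw [cnt_comp]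
  have h1 := key (fun _ => 1)
  have h2 : ∑ v ∈ univ.filter (fun v : Fin n → Bool => hw v = m),
      ∑ σ : Fin (hw v) ≃ {i : Fin n // v i = true}, (1 : ℝ) = m.factorial * n.choose m := by
    rw [sum_congr rfl (g := fun _ => (m.factorial : ℝ))]
    · simp [card_level, mul_comm]
    · intro v hv
      simp only [mem_filter, mem_univ, true_and] at hv
      subst hv
      simp [card_walks]
  rw [h2] at h1
  have h3 : lev (n := n) (fun _ => (1 : ℝ)) (m - t) = n.choose (m - t) := by
    simp [lev, card_level]
  rw [key F, h1, h3, lev_eq F (by omega)]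
  ring

lemma walkPos_le {n : ℕ} (v : Fin n → Bool) (σ : Fin (hw v) ≃ {i : Fin n // v i = true})
    (t : ℕ) (i : Fin n) : walkPos v σ t i ≤ v i := by
  unfold walkPos
  exact Bool.and_le_left _ _

lemma fR_walk_le {n : ℕ} {f : (Fin n → Bool) → Bool} (hf : MonotoneBF f) (v : Fin n → Bool)
    (σ : Fin (hw v) ≃ {i : Fin n // v i = true}) (t : ℕ) :
    fR f (walkPos v σ t) ≤ fR f v := by
  have := hf _ _ (walkPos_le v σ t)
  unfold fR
  by_cases h1 : f (walkPos v σ t) = true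
  · rw [h1] at this
    have h2 : f v = true := by
      revert this; cases f v <;> simp
    simp [h1, h2]
  · rw [if_neg h1]; split_ifs <;> norm_num

lemma walkPos_zero {n : ℕ} (v : Fin n → Bool) (σ : Fin (hw v) ≃ {i : Fin n // v i = true}) :
    walkPos v σ 0 = v := by
  ext i; simp [walkPos]

lemma mu_step {n : ℕ} {f : (Fin n → Bool) → Bool} (hf : MonotoneBF f) {m : ℕ} (hm : m ≤ n) :
    mu (fR f) (m - 1) ≤ mu (fR f) m := by
  have h1 := sum_walk n m 1 hm (fR f)
  have h0 := sum_walk n m 0 hm (fR f)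
  have hpos : (0 : ℝ) < (m.factorial : ℝ) * (n.choose m) := by
    have := Nat.choose_pos hm
    positivity
  have hle : (m.factorial : ℝ) * (n.choose m) * mu (fR f) (m - 1) ≤
      (m.factorial : ℝ) * (n.choose m) * mu (fR f) (m - 0) := by
    rw [← h1, ← h0]
    refine sum_le_sum fun v _ => sum_le_sum fun σ _ => ?_
    rw [walkPos_zero]
    exact fR_walk_le hf v σ 1
  exact le_of_mul_le_mul_left hle hpos

lemma mu_nonneg {n : ℕ} (f : (Fin n → Bool) → Bool) (k : ℕ) : 0 ≤ mu (fR f) k := by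
  unfold mu lev fR
  refine div_nonneg (sum_nonneg fun y _ => ?_) (by positivity)
  split_ifs <;> norm_num

lemma mu_le_one {n : ℕ} (f : (Fin n → Bool) → Bool) (k : ℕ) : mu (fR f) k ≤ 1 := by
  unfold mu lev fR
  refine div_le_one_of_le₀ ?_ (by positivity)
  rw [← card_level, card_eq_sum_ones]
  push_cast
  refine sum_le_sum fun y _ => ?_
  split_ifs <;> norm_num

/-- The walk probability in terms of level averages. -/
lemma walkProb_eq {n : ℕ} {f : (Fin n → Bool) → Bool} (hf : MonotoneBF f) (w C : ℕ) (c : ℝ)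
    (hC : ⌈c⌉ = (C : ℤ)) :
    walkProb (fun v σ => f v = true ∧ f (walkPos v σ (nsteps w c v)) = false) =
      (2 ^ n : ℝ)⁻¹ * ∑ m ∈ range (n + 1), (n.choose m : ℝ) *
        (mu (fR f) m - mu (fR f) (m - min w (m - C))) := by
  unfold walkProb
  congr 1
  have hmaps : ∀ v ∈ (univ : Finset (Fin n → Bool)), hw v ∈ range (n + 1) := by
    intro v _
    rw [mem_range]
    have := hw_le v
    omega
  rw [← sum_fiberwise_of_maps_to hmaps]
  refine sum_congr rfl fun m hm => ?_
  have hmn : m ≤ n := by rw [mem_range] at hm; omega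
  have h1 := sum_walk n m (min w (m - C)) hmn (fR f)
  have h0 := sum_walk n m 0 hmn (fR f)
  have hfac : (m.factorial : ℝ) ≠ 0 := by positivity
  rw [Nat.sub_zero] at h0
  have : (n.choose m : ℝ) * (mu (fR f) m - mu (fR f) (m - min w (m - C))) =
      ((m.factorial : ℝ) * n.choose m * mu (fR f) m -
        (m.factorial : ℝ) * n.choose m * mu (fR f) (m - min w (m - C))) / m.factorial := by
    field_simp
  rw [this, ← h0, ← h1, ← sum_sub_distrib, sum_div]
  refine sum_congr rfl fun v hv => ?_
  simp only [mem_filter, mem_univ, true_and] at hv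
  subst hv
  rw [← sum_sub_distrib]
  congr 1
  have hn : nsteps w c v = min w (hw v - C) := by
    unfold nsteps
    rw [hC]
    congr 1
    omega
  simp only [hn]
  classical
  rw [Nat.card_eq_fintype_card, Fintype.card_subtype, card_eq_sum_ones, sum_filter]
  push_cast
  refine sum_congr rfl fun σ _ => ?_
  rw [walkPos_zero]
  have h := fR_walk_le hf v σ (min w (hw v - C))
  unfold fR at h ⊢
  by_cases ha : f v = true <;> by_cases hb : f (walkPos v σ (min w (hw v - C))) = true <;>
    simp [ha, hb] at h ⊢
  linarith

lemma hw_sum {n : ℕ} (x : Fin n → Bool) :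
    ∑ i, (if x i = true then (1 : ℝ) else -1) = 2 * (hw x : ℝ) - n := by
  have h1 : ∀ i, (if x i = true then (1 : ℝ) else -1) = 2 * (if x i = true then 1 else 0) - 1 := by
    intro i; split_ifs <;> norm_num
  simp only [h1]
  rw [sum_sub_distrib, ← mul_sum]
  simp [hw]

lemma bflip_bflip {n : ℕ} (x : Fin n → Bool) (i : Fin n) : bflip (bflip x i) i = x := by
  ext j
  unfold bflip
  by_cases h : j = i
  · subst h; simp
  · simp [h]

lemma infl_eq {n : ℕ} {f : (Fin n → Bool) → Bool} (hf : MonotoneBF f) (i : Fin n) :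
    infl f i = 2 * (2 ^ n : ℝ)⁻¹ *
      ∑ x : Fin n → Bool, fR f x * (if x i = true then (1 : ℝ) else -1) := by
  have h1 : ∀ x : Fin n → Bool, (if f x ≠ f (bflip x i) then (1 : ℝ) else 0) =
      fR f x * (if x i = true then (1 : ℝ) else -1) +
      fR f (bflip x i) * (if (bflip x i) i = true then (1 : ℝ) else -1) := by
    intro x
    have hb : (bflip x i) i = !x i := by simp [bflip]
    rw [hb]
    unfold fR
    by_cases hx : x i = true
    · have hle : f (bflip x i) ≤ f x := hf _ _ (fun j => by
        unfold bflip
        by_cases h : j = i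
        · subst h; simp [hx]
        · simp [h])
      revert hle
      rw [hx]
      cases f x <;> cases f (bflip x i) <;> simp
    · have hx' : x i = false := by simpa using hx
      have hle : f x ≤ f (bflip x i) := hf _ _ (fun j => by
        unfold bflip
        by_cases h : j = i
        · subst h; simp [hx']
        · simp [h])
      revert hle
      rw [hx']
      cases f x <;> cases f (bflip x i) <;> simp
  have hinv : Function.Involutive (fun x : Fin n → Bool => bflip x i) := fun x => bflip_bflip x i
  have h2 : ∑ x : Fin n → Bool,
        fR f (bflip x i) * (if (bflip x i) i = true then (1 : ℝ) else -1) =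
      ∑ x : Fin n → Bool, fR f x * (if x i = true then (1 : ℝ) else -1) :=
    Equiv.sum_comp hinv.toPerm
      (fun x : Fin n → Bool => fR f x * (if x i = true then (1 : ℝ) else -1))
  unfold infl
  rw [card_eq_sum_ones, sum_filter]
  push_cast
  rw [sum_congr rfl (fun x _ => h1 x), sum_add_distrib, h2]
  ring

lemma sum_level {n : ℕ} (F : (Fin n → Bool) → ℝ) (g : ℕ → ℝ) :
    ∑ x : Fin n → Bool, F x * g (hw x) =
      ∑ k ∈ range (n + 1), (n.choose k : ℝ) * mu F k * g k := by
  have hmaps : ∀ v ∈ (univ : Finset (Fin n → Bool)), hw v ∈ range (n + 1) := by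
    intro v _
    rw [mem_range]
    have := hw_le v
    omega
  rw [← sum_fiberwise_of_maps_to hmaps]
  refine sum_congr rfl fun m hm => ?_
  have hmn : m ≤ n := by rw [mem_range] at hm; omega
  rw [← lev_eq F hmn, lev, sum_mul]
  refine sum_congr rfl fun x hx => ?_
  simp only [mem_filter, mem_univ, true_and] at hx
  rw [hx]

lemma totalInfl_eq {n : ℕ} {f : (Fin n → Bool) → Bool} (hf : MonotoneBF f) :
    totalInfl f = 2 * (2 ^ n : ℝ)⁻¹ *
      ∑ k ∈ range (n + 1), (n.choose k : ℝ) * mu (fR f) k * (2 * (k : ℝ) - n) := by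
  rw [← sum_level (fR f) (fun k => 2 * (k : ℝ) - n)]
  unfold totalInfl
  simp only [infl_eq hf, ← hw_sum]
  rw [← mul_sum, sum_comm]
  simp only [mul_sum]

lemma abel (n : ℕ) (μ : ℕ → ℝ) :
    ∑ k ∈ range (n + 1), (n.choose k : ℝ) * μ k * (2 * (k : ℝ) - n) =
      ∑ k ∈ range n, ((k : ℝ) + 1) * (n.choose (k + 1) : ℝ) * (μ (k + 1) - μ k) := by
  have h1 : ∀ k ∈ range (n + 1), (n.choose k : ℝ) * μ k * (2 * (k : ℝ) - n) =
      (k : ℝ) * n.choose k * μ k - ((k : ℝ) + 1) * (n.choose (k + 1) : ℝ) * μ k := by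
    intro k hk
    have hkn : k ≤ n := by rw [mem_range] at hk; omega
    have := Nat.choose_succ_right_eq n k
    have h : (n.choose (k + 1) : ℝ) * ((k : ℝ) + 1) = n.choose k * ((n : ℝ) - k) := by
      rw [← Nat.cast_sub hkn]
      exact_mod_cast this
    linear_combination μ k * h
  rw [sum_congr rfl h1, sum_sub_distrib, sum_range_succ', sum_range_succ
    (fun k : ℕ => ((k : ℝ) + 1) * (n.choose (k + 1) : ℝ) * μ k)]
  simp only [Nat.choose_succ_self, mul_sub, sum_sub_distrib]
  push_cast
  ring

lemma sum_walk_edges (n w C : ℕ) (μ : ℕ → ℝ) :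
    ∑ m ∈ range (n + 1), (n.choose m : ℝ) * (μ m - μ (m - min w (m - C))) =
      ∑ k ∈ range n, (if C ≤ k then ∑ t ∈ range w, (n.choose (k + 1 + t) : ℝ) else 0) *
        (μ (k + 1) - μ k) := by
  have h1 : ∀ m ∈ range (n + 1), (n.choose m : ℝ) * (μ m - μ (m - min w (m - C))) =
      ∑ k ∈ range n, if (C ≤ k ∧ k + 1 ≤ m ∧ m < k + 1 + w) then
        (n.choose m : ℝ) * (μ (k + 1) - μ k) else 0 := by
    intro m hm
    rw [mem_range] at hm
    rw [← sum_Ico_sub μ (Nat.sub_le m (min w (m - C))), mul_sum, ← sum_filter]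
    refine sum_congr ?_ fun _ _ => rfl
    ext k
    simp only [mem_Ico, mem_filter, mem_range]
    omega
  rw [sum_congr rfl h1, sum_comm]
  refine sum_congr rfl fun k hk => ?_
  by_cases hC : C ≤ k
  · simp only [hC, true_and, if_true]
    rw [← sum_filter, sum_mul]
    have : (∑ t ∈ range w, (n.choose (k + 1 + t) : ℝ) * (μ (k + 1) - μ k)) =
        ∑ m ∈ Ico (k + 1) (k + 1 + w), (n.choose m : ℝ) * (μ (k + 1) - μ k) := by
      rw [sum_Ico_eq_sum_range]
      simp
    rw [this]
    refine sum_subset ?_ ?_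
    · intro m
      simp only [mem_Ico, mem_filter, mem_range]
      omega
    · intro m hm hm'
      simp only [mem_Ico, mem_filter, mem_range] at hm hm'
      rw [Nat.choose_eq_zero_of_lt (by omega)]
      simp
  · simp [hC]

lemma sum_choose_sq (n : ℕ) :
    ∑ k ∈ range (n + 1), (n.choose k : ℝ) * (2 * (k : ℝ) - n) ^ 2 = (n : ℝ) * 2 ^ n := by
  have h := congrArg (Polynomial.eval (1 / 2 : ℝ)) (bernsteinPolynomial.variance ℝ n)
  simp only [Polynomial.eval_finsetSum, Polynomial.eval_mul, Polynomial.eval_pow,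
    Polynomial.eval_sub, Polynomial.eval_X, bernsteinPolynomial,
    Polynomial.eval_natCast, Polynomial.eval_one, nsmul_eq_mul] at h
  have h2 : ∀ k ∈ range (n + 1), (n.choose k : ℝ) * (2 * (k : ℝ) - n) ^ 2 =
      4 * 2 ^ n * (((n : ℝ) * (1 / 2) - k) ^ 2 *
        ((n.choose k : ℝ) * (1 / 2) ^ k * (1 - 1 / 2) ^ (n - k))) := by
    intro k hk
    have hkn : k ≤ n := by rw [mem_range] at hk; omega
    have : (1 / 2 : ℝ) ^ k * (1 - 1 / 2) ^ (n - k) * 2 ^ n = 1 := by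
      rw [show (1 - 1 / 2 : ℝ) = 1 / 2 by norm_num, ← pow_add, Nat.add_sub_cancel' hkn, ← mul_pow]
      norm_num
    linear_combination (-(n.choose k : ℝ) * (2 * (k : ℝ) - n) ^ 2) * this
  rw [sum_congr rfl h2, ← mul_sum, h]
  ring

lemma totalInfl_le {n : ℕ} {f : (Fin n → Bool) → Bool} (hf : MonotoneBF f) :
    totalInfl f ≤ 2 * Real.sqrt n := by
  have h1 := sum_choose_sq n
  have hc := sum_mul_sq_le_sq_mul_sq (range (n + 1))
    (fun k => Real.sqrt (n.choose k) * mu (fR f) k)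
    (fun k => Real.sqrt (n.choose k) * (2 * (k : ℝ) - n))
  have e1 : ∀ k, Real.sqrt (n.choose k) * mu (fR f) k * (Real.sqrt (n.choose k) * (2 * (k : ℝ) - n))
      = (n.choose k : ℝ) * mu (fR f) k * (2 * (k : ℝ) - n) := by
    intro k
    have := Real.mul_self_sqrt (Nat.cast_nonneg (α := ℝ) (n.choose k))
    linear_combination (mu (fR f) k * (2 * (k : ℝ) - n)) * this
  have e2 : ∀ k, (Real.sqrt (n.choose k) * (2 * (k : ℝ) - n)) ^ 2
      = (n.choose k : ℝ) * (2 * (k : ℝ) - n) ^ 2 := by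
    intro k
    rw [mul_pow, Real.sq_sqrt (by positivity)]
  have e3 : ∑ k ∈ range (n + 1), (Real.sqrt (n.choose k) * mu (fR f) k) ^ 2 ≤ 2 ^ n := by
    have h2 : ∑ k ∈ range (n + 1), (n.choose k : ℝ) = 2 ^ n := by
      exact_mod_cast Nat.sum_range_choose n
    rw [← h2]
    refine sum_le_sum fun k _ => ?_
    rw [mul_pow, Real.sq_sqrt (by positivity)]
    have a := mu_nonneg f k
    have b := mu_le_one f k
    have : mu (fR f) k ^ 2 ≤ 1 := by nlinarith
    have hc0 : (0 : ℝ) ≤ n.choose k := by positivity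
    nlinarith
  simp only [e1, e2] at hc
  rw [h1] at hc
  rw [totalInfl_eq hf]
  set S := ∑ k ∈ range (n + 1), (n.choose k : ℝ) * mu (fR f) k * (2 * (k : ℝ) - n)
  have hS : S ^ 2 ≤ (2 ^ n * Real.sqrt n) ^ 2 := by
    rw [mul_pow, Real.sq_sqrt (by positivity)]
    calc S ^ 2 ≤ _ := hc
      _ ≤ 2 ^ n * ((n : ℝ) * 2 ^ n) := by gcongr
      _ = _ := by ring
  have := abs_le_of_sq_le_sq hS (by positivity)
  have h3 : S ≤ 2 ^ n * Real.sqrt n := (abs_le.1 this).2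
  calc 2 * (2 ^ n : ℝ)⁻¹ * S ≤ 2 * (2 ^ n : ℝ)⁻¹ * (2 ^ n * Real.sqrt n) := by gcongr
    _ = 2 * Real.sqrt n := by field_simp

lemma sum_choose_exp (n : ℕ) (l : ℝ) :
    ∑ k ∈ range (n + 1), (n.choose k : ℝ) * Real.exp (l * (2 * (k : ℝ) - n)) ≤
      2 ^ n * Real.exp (n * l ^ 2 / 2) := by
  have h : ∑ k ∈ range (n + 1), (n.choose k : ℝ) * Real.exp (l * (2 * (k : ℝ) - n)) =
      (Real.exp l + Real.exp (-l)) ^ n := by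
    rw [add_pow]
    refine sum_congr rfl fun k hk => ?_
    have hkn : k ≤ n := by rw [mem_range] at hk; omega
    rw [← Real.exp_nat_mul, ← Real.exp_nat_mul, ← Real.exp_add, mul_comm, Nat.cast_sub hkn]
    congr 2
    ring
  rw [h]
  have h2 : Real.exp l + Real.exp (-l) = 2 * Real.cosh l := by
    rw [Real.cosh_eq]; ring
  rw [h2, mul_pow]
  have h3 := Real.cosh_le_exp_half_sq l
  have h4 : Real.exp (n * l ^ 2 / 2) = Real.exp (l ^ 2 / 2) ^ n := by
    rw [← Real.exp_nat_mul]; congr 1; ring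
  rw [h4]
  have := Real.cosh_pos l
  gcongr

lemma tail_bound (n : ℕ) (hn : 0 < n) (s : ℝ) (hs : 0 ≤ s) :
    ∑ k ∈ (range (n + 1)).filter (fun k : ℕ => s < |(k : ℝ) - n / 2|), (n.choose k : ℝ) ≤
      2 * 2 ^ n * Real.exp (-(2 * s ^ 2 / n)) := by
  have hn' : (0 : ℝ) < n := by exact_mod_cast hn
  set l : ℝ := 2 * s / n with hl
  have hl0 : 0 ≤ l := by positivity
  have h1 := sum_choose_exp n l
  have h2 := sum_choose_exp n (-l)
  have hE : Real.exp (n * l ^ 2 / 2) = Real.exp (-(2 * s ^ 2 / n)) * Real.exp (2 * l * s) := by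
    rw [← Real.exp_add]; congr 1; rw [hl]; field_simp; ring
  have key : (∑ k ∈ (range (n + 1)).filter (fun k : ℕ => s < |(k : ℝ) - n / 2|),
      (n.choose k : ℝ)) * Real.exp (2 * l * s) ≤
      ∑ k ∈ range (n + 1), (n.choose k : ℝ) * Real.exp (l * (2 * (k : ℝ) - n)) +
      ∑ k ∈ range (n + 1), (n.choose k : ℝ) * Real.exp (-l * (2 * (k : ℝ) - n)) := by
    rw [← sum_add_distrib, sum_mul]
    refine (sum_le_sum fun k hk => ?_).trans
      (sum_le_sum_of_subset_of_nonneg (filter_subset _ _) fun k _ _ => by positivity)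
    rw [mem_filter] at hk
    rw [← mul_add]
    refine mul_le_mul_of_nonneg_left ?_ (by positivity)
    rcases lt_abs.1 hk.2 with h | h
    · have : Real.exp (2 * l * s) ≤ Real.exp (l * (2 * (k : ℝ) - n)) :=
        Real.exp_le_exp.2 (by nlinarith)
      have := Real.exp_pos (-l * (2 * (k : ℝ) - n))
      linarith
    · have : Real.exp (2 * l * s) ≤ Real.exp (-l * (2 * (k : ℝ) - n)) :=
        Real.exp_le_exp.2 (by nlinarith)
      have := Real.exp_pos (l * (2 * (k : ℝ) - n))
      linarith
  rw [neg_sq] at h2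
  rw [hE] at h1 h2
  have hp := Real.exp_pos (2 * l * s)
  refine le_of_mul_le_mul_right (key.trans ?_) hp
  linarith

lemma choose_rec (n j : ℕ) :
    (n.choose (j + 1) : ℝ) * ((j : ℝ) + 1) = n.choose j * ((n : ℝ) - j) := by
  by_cases h : j ≤ n
  · rw [← Nat.cast_sub h]
    exact_mod_cast Nat.choose_succ_right_eq n j
  · rw [Nat.choose_eq_zero_of_lt (by omega), Nat.choose_eq_zero_of_lt (by omega)]
    simp

lemma choose_up (n k : ℕ) (ρ : ℝ) (hρ : 0 ≤ ρ) (h : (n : ℝ) - k ≤ ρ * (k + 1)) (t : ℕ) :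
    (n.choose (k + t) : ℝ) ≤ ρ ^ t * n.choose k := by
  induction t with
  | zero => simp
  | succ t ih =>
    have h1 := choose_rec n (k + t)
    push_cast at h1
    have ht : (0 : ℝ) ≤ t := Nat.cast_nonneg t
    have hk : (0 : ℝ) ≤ k := Nat.cast_nonneg k
    have h2 : (n : ℝ) - (k + t) ≤ ρ * (k + t + 1) := by nlinarith [mul_nonneg hρ ht]
    have h3 : (n.choose (k + t + 1) : ℝ) * ((k : ℝ) + t + 1) ≤
        (ρ * n.choose (k + t)) * ((k : ℝ) + t + 1) := by
      rw [h1]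
      have : (0 : ℝ) ≤ n.choose (k + t) := by positivity
      nlinarith
    have h4 := le_of_mul_le_mul_right h3 (by positivity)
    rw [← add_assoc]
    calc (n.choose (k + t + 1) : ℝ) ≤ ρ * n.choose (k + t) := h4
      _ ≤ ρ * (ρ ^ t * n.choose k) := by gcongr
      _ = _ := by ring

lemma choose_lo (n k w : ℕ) (r : ℝ) (hr : 0 ≤ r)
    (h : r * ((k : ℝ) + w) ≤ n - (k + w)) (t : ℕ) (ht : t ≤ w) :
    r ^ t * n.choose k ≤ (n.choose (k + t) : ℝ) := by
  induction t with
  | zero => simp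
  | succ t ih =>
    have h1 := choose_rec n (k + t)
    push_cast at h1
    have htw : (t : ℝ) + 1 ≤ w := by exact_mod_cast ht
    have hk : (0 : ℝ) ≤ k := Nat.cast_nonneg k
    have ht0 : (0 : ℝ) ≤ t := Nat.cast_nonneg t
    have h2 : r * (k + t + 1) ≤ (n : ℝ) - (k + t) := by
      have : r * ((k : ℝ) + t + 1) ≤ r * (k + w) := by
        apply mul_le_mul_of_nonneg_left _ hr
        linarith
      linarith
    have h3 : (r * n.choose (k + t)) * ((k : ℝ) + t + 1) ≤
        (n.choose (k + t + 1) : ℝ) * ((k : ℝ) + t + 1) := by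
      rw [h1]
      have : (0 : ℝ) ≤ n.choose (k + t) := by positivity
      nlinarith
    have h4 := le_of_mul_le_mul_right h3 (by positivity)
    rw [← add_assoc]
    calc r ^ (t + 1) * n.choose k = r * (r ^ t * n.choose k) := by ring
      _ ≤ r * n.choose (k + t) := by
        have := ih (by omega)
        gcongr
      _ ≤ _ := h4

lemma edge_up (n K w : ℕ) (hn : 0 < n) (ε δ : ℝ) (hε0 : 0 < ε) (hε1 : ε < 1)
    (hδ0 : 0 ≤ δ) (hδ : δ < ε / 8) (hwδ : w * δ ≤ ε / 32) (hK : (n : ℝ) / 2 * (1 - δ) ≤ K) :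
    ∑ t ∈ range w, (n.choose (K + t) : ℝ) ≤ (1 + ε) * (2 * w / n) * (K * n.choose K) := by
  have hn' : (0 : ℝ) < n := by exact_mod_cast hn
  have h1δ : 0 < 1 - δ := by linarith
  set ρ : ℝ := (1 + δ) / (1 - δ) with hρ
  have hρ1 : 1 ≤ ρ := by
    rw [hρ, le_div_iff₀ h1δ]; linarith
  have hstep : (n : ℝ) - K ≤ ρ * (K + 1) := by
    have : ρ * ((n : ℝ) / 2 * (1 - δ)) = n / 2 * (1 + δ) := by
      rw [hρ]; field_simp
    nlinarith
  have hpow : ρ ^ w * (1 - 2 * (w * δ)) ≤ 1 := by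
    have hb := one_add_mul_le_pow (a := -(2 * δ)) (by linarith) w
    have hρ2 : ρ * (1 + -(2 * δ)) ≤ 1 := by
      rw [hρ, div_mul_eq_mul_div, div_le_one h1δ]
      nlinarith
    have h0 : 0 ≤ ρ * (1 + -(2 * δ)) := mul_nonneg (by linarith) (by linarith)
    calc ρ ^ w * (1 - 2 * (w * δ)) ≤ ρ ^ w * (1 + -(2 * δ)) ^ w := by
          apply mul_le_mul_of_nonneg_left _ (by positivity)
          linarith
      _ = (ρ * (1 + -(2 * δ))) ^ w := by rw [mul_pow]
      _ ≤ 1 := pow_le_one₀ h0 hρ2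
  have hb : ρ ^ w ≤ (1 + ε) * (1 - δ) := by
    have hp : 0 < 1 - 2 * (w * δ) := by linarith
    refine le_of_mul_le_mul_right (hpow.trans ?_) hp
    have h1 : 1 - ε / 8 ≤ 1 - δ := by linarith
    have h2 : 1 - ε / 16 ≤ 1 - 2 * (w * δ) := by linarith
    have h3 : (1 - ε / 8) * (1 - ε / 16) ≤ (1 - δ) * (1 - 2 * (w * δ)) :=
      mul_le_mul h1 h2 (by linarith) (by linarith)
    have h4 : 1 ≤ (1 + ε) * ((1 - ε / 8) * (1 - ε / 16)) := by nlinarith [mul_pos hε0 hε0, mul_nonneg (mul_pos hε0 hε0).le hε0.le]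
    calc (1 : ℝ) ≤ _ := h4
      _ ≤ (1 + ε) * ((1 - δ) * (1 - 2 * (w * δ))) := by gcongr
      _ = _ := by ring
  have hK2 : 1 - δ ≤ 2 * K / n := by
    rw [le_div_iff₀ hn']; linarith
  calc ∑ t ∈ range w, (n.choose (K + t) : ℝ)
      ≤ ∑ t ∈ range w, (1 + ε) * (2 * K / n) * n.choose K := by
        refine sum_le_sum fun t ht => ?_
        rw [mem_range] at ht
        refine (choose_up n K ρ (by linarith) hstep t).trans ?_
        refine mul_le_mul_of_nonneg_right ?_ (by positivity)
        calc ρ ^ t ≤ ρ ^ w := pow_le_pow_right₀ hρ1 ht.le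
          _ ≤ _ := hb
          _ ≤ _ := by gcongr
    _ = _ := by
      rw [sum_const, card_range, nsmul_eq_mul]; ring

lemma edge_lo (n K w : ℕ) (hn : 0 < n) (ε δ : ℝ) (hε0 : 0 < ε) (hε1 : ε < 1)
    (hδ0 : 0 ≤ δ) (hδ : δ < ε / 8) (hwδ : w * δ ≤ ε / 32) (hw1 : 1 ≤ w)
    (hww : (w : ℝ) ^ 2 ≤ ε / 64 * n)
    (hK : (K : ℝ) ≤ (n : ℝ) / 2 * (1 + δ)) :
    (1 - ε / 2) * (2 * w / n) * (K * n.choose K) ≤ ∑ t ∈ range w, (n.choose (K + t) : ℝ) := by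
  have hn' : (0 : ℝ) < n := by exact_mod_cast hn
  have hw1' : (1 : ℝ) ≤ w := by exact_mod_cast hw1
  set q : ℝ := w / n with hq
  have hqn : q * n = w := by rw [hq]; field_simp
  have hq0 : 0 ≤ q := by positivity
  have hwq : w * q ≤ ε / 64 := by
    rw [hq, mul_div_assoc', div_le_iff₀ hn']; nlinarith
  have hq1 : q ≤ ε / 64 := by nlinarith
  set a : ℝ := 2 * (δ + 2 * q) with ha
  have hstep : (1 - a) * ((K : ℝ) + w) ≤ n - (K + w) := by
    have h1 : (K : ℝ) + w ≤ n / 2 * (1 + (δ + 2 * q)) := by rw [← hqn]; linarith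
    have h2 : (2 - a) * ((K : ℝ) + w) ≤ (2 - a) * (n / 2 * (1 + (δ + 2 * q))) :=
      mul_le_mul_of_nonneg_left h1 (by linarith)
    have h3 : (2 - a) * (n / 2 * (1 + (δ + 2 * q))) = n * (1 - (δ + 2 * q) ^ 2) := by
      rw [ha]; ring
    nlinarith [mul_nonneg hn'.le (sq_nonneg (δ + 2 * q))]
  have ha0 : 0 ≤ a := by rw [ha]; linarith
  have ha1 : 0 ≤ 1 - a := by rw [ha]; linarith
  have hb : (1 - ε / 2) * (2 * K / n) ≤ (1 - a) ^ w := by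
    have hb := one_add_mul_le_pow (a := -a) (by linarith) w
    have h1 : 1 - ε / 8 ≤ (1 - a) ^ w := by
      have : (w : ℝ) * a = 2 * (w * δ) + 4 * (w * q) := by rw [ha]; ring
      have h2 : 1 + (w : ℝ) * -a = 1 - w * a := by ring
      rw [h2] at hb
      have h3 : (1 + -a) = 1 - a := by ring
      rw [h3] at hb
      linarith
    have h2 : 2 * (K : ℝ) / n ≤ 1 + ε / 8 := by
      rw [div_le_iff₀ hn']; nlinarith
    have h3 : (1 - ε / 2) * (2 * K / n) ≤ (1 - ε / 2) * (1 + ε / 8) :=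
      mul_le_mul_of_nonneg_left h2 (by linarith)
    nlinarith
  calc _ = ∑ t ∈ range w, (1 - ε / 2) * (2 * K / n) * n.choose K := by
        rw [sum_const, card_range, nsmul_eq_mul]; ring
    _ ≤ _ := by
        refine sum_le_sum fun t ht => ?_
        rw [mem_range] at ht
        refine le_trans ?_ (choose_lo n K w (1 - a) ha1 hstep t ht.le)
        refine mul_le_mul_of_nonneg_right ?_ (by positivity)
        exact hb.trans (pow_le_pow_of_le_one ha1 (by linarith) ht.le)

lemma params (n w : ℕ) (hn : 0 < n) (I ε s : ℝ) (hε0 : 0 < ε) (hε1 : ε < 1)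
    (hI1 : 1 ≤ I) (hI2 : I ≤ 2 * Real.sqrt n)
    (hεn : 8 * Real.sqrt (2 * Real.log (8 * n / ε)) / Real.sqrt n < ε)
    (hs : s = (1 / 2) * Real.sqrt (2 * n * Real.log (2 * n / (ε / 4))))
    (hw2 : (w : ℝ) ≤
      ε / 4 * Real.sqrt n / (16 * Real.sqrt (2 * Real.log (2 * n / (ε / 4 * I))))) :
    2 * s / n < ε / 8 ∧ w * (2 * s / n) ≤ ε / 32 ∧ (w : ℝ) ^ 2 ≤ ε / 64 * n ∧
      Real.exp (-(2 * s ^ 2 / n)) = ε / (8 * n) := by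
  have hn' : (1 : ℝ) ≤ n := by exact_mod_cast hn
  have hn0 : (0 : ℝ) < n := by linarith
  have he : 2 * (n : ℝ) / (ε / 4) = 8 * n / ε := by field_simp; norm_num
  rw [he] at hs
  have hX : 0 < 8 * n / ε := by positivity
  have hX8 : 8 ≤ 8 * n / ε := by
    rw [le_div_iff₀ hε0]; nlinarith
  set L := Real.log (8 * n / ε) with hL
  have hL1 : 1 ≤ L := by
    rw [hL, Real.le_log_iff_exp_le hX]
    have := Real.exp_one_lt_d9
    linarith
  set R := Real.sqrt n with hR
  have hR0 : 0 < R := Real.sqrt_pos.2 hn0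
  have hR2 : R ^ 2 = n := Real.sq_sqrt hn0.le
  set Q := Real.sqrt L with hQ
  have hQ2 : Q ^ 2 = L := Real.sq_sqrt (by linarith)
  have hQ1 : 1 ≤ Q := by
    rw [hQ, Real.one_le_sqrt]; exact hL1
  have hs' : s = (1 / 2) * (R * Real.sqrt (2 * L)) := by
    rw [hs, hR, ← Real.sqrt_mul hn0.le]; congr 2; ring
  have h2L : Real.sqrt (2 * L) = Real.sqrt 2 * Q := by
    rw [Real.sqrt_mul (by norm_num)]
  have hδ : 2 * s / n = Real.sqrt (2 * L) / R := by
    rw [hs', ← hR2]; field_simp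
  have hs2 : 2 * s ^ 2 / n = L := by
    rw [hs', mul_pow, mul_pow, hR2, Real.sq_sqrt (by linarith)]; field_simp
  -- log comparison
  have hcmp : L ≤ 2 * Real.log (2 * n / (ε / 4 * I)) := by
    have hI0 : 0 < I := by linarith
    have hlow : 4 * R / ε ≤ 2 * n / (ε / 4 * I) := by
      rw [div_le_div_iff₀ hε0 (by positivity), ← hR2]
      have : 0 ≤ ε * R := by positivity
      nlinarith
    have hsq : 8 * n / ε ≤ (4 * R / ε) ^ 2 := by
      rw [div_pow, mul_pow, hR2, div_le_div_iff₀ hε0 (by positivity)]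
      have : 0 ≤ (n : ℝ) * ε := by positivity
      nlinarith
    have h1 : L ≤ Real.log ((4 * R / ε) ^ 2) := Real.log_le_log hX hsq
    rw [Real.log_pow] at h1
    have h2 := Real.log_le_log (by positivity) hlow
    push_cast at h1
    linarith
  have hQle : Q ≤ Real.sqrt (2 * Real.log (2 * n / (ε / 4 * I))) := Real.sqrt_le_sqrt hcmp
  have hw3 : (w : ℝ) * (64 * Q) ≤ ε * R := by
    have hpos : 0 < 16 * Real.sqrt (2 * Real.log (2 * n / (ε / 4 * I))) := by linarith
    rw [le_div_iff₀ hpos] at hw2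
    have hw0 : (0 : ℝ) ≤ w := Nat.cast_nonneg w
    nlinarith [mul_le_mul_of_nonneg_left hQle hw0]
  have hw0 : (0 : ℝ) ≤ w := Nat.cast_nonneg w
  have hsqrt2 : Real.sqrt 2 ≤ 2 := by
    rw [Real.sqrt_le_left (by norm_num)]; norm_num
  refine ⟨?_, ?_, ?_, ?_⟩
  · rw [hδ]
    rw [mul_div_assoc] at hεn
    linarith
  · rw [hδ, h2L, mul_div_assoc', div_le_iff₀ hR0]
    have : Real.sqrt 2 * (w * Q) ≤ 2 * (w * Q) :=
      mul_le_mul_of_nonneg_right hsqrt2 (by positivity)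
    linarith
  · have hw4 : (w : ℝ) * 64 ≤ ε * R := by
      have h6 := mul_le_mul_of_nonneg_left hQ1 hw0
      linarith
    have hw5 : ((w : ℝ) * 64) ^ 2 ≤ (ε * R) ^ 2 := by gcongr
    rw [mul_pow, mul_pow, hR2] at hw5
    have : ε ^ 2 * n ≤ ε * n := by
      apply mul_le_mul_of_nonneg_right _ hn0.le; nlinarith
    have h5 : 0 ≤ ε * n := by positivity
    linarith
  · rw [hs2, Real.exp_neg, hL, Real.exp_log hX, inv_div]

/-- Main Lemma: for monotone `f` with `I[f] ≥ 1`, `ε ∈ (0,1)` with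
`ε > 8√(2log(8n/ε))/√n`, `ε̃ = ε/4`, `s* = (1/2)√(2n·log(2n/ε̃))` and a positive
integer `w ≤ ε̃√n/(16√(2log(2n/(ε̃·I[f]))))`, the probability `p_{w,s*}(f)` that a
random walk of length `w` down the Boolean lattice with cutoff at level `n/2 − s* − 1`,
from a uniform start, starts at `v` with `f(v) = 1` and ends at `u` with `f(u) = 0`
satisfies `(1 − ε)·(w/n)·I[f] ≤ p_{w,s*}(f) ≤ (1 + ε)·(w/n)·I[f]`. -/
theorem main_lemma (n : ℕ) (f : (Fin n → Bool) → Bool) (hmono : MonotoneBF f)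
    (hI : 1 ≤ totalInfl f) (ε : ℝ) (hε0 : 0 < ε) (hε1 : ε < 1)
    (hεn : 8 * Real.sqrt (2 * Real.log (8 * n / ε)) / Real.sqrt n < ε)
    (εt : ℝ) (hεt : εt = ε / 4)
    (s : ℝ) (hs : s = (1 / 2) * Real.sqrt (2 * n * Real.log (2 * n / εt)))
    (w : ℕ) (hw1 : 1 ≤ w)
    (hw2 : (w : ℝ) ≤
      εt * Real.sqrt n / (16 * Real.sqrt (2 * Real.log (2 * n / (εt * totalInfl f))))) :
    (1 - ε) * ((w : ℝ) / n) * totalInfl f ≤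
      walkProb (fun v σ => f v = true ∧
        f (walkPos v σ (nsteps w ((n : ℝ) / 2 - s - 1) v)) = false) ∧
    walkProb (fun v σ => f v = true ∧
        f (walkPos v σ (nsteps w ((n : ℝ) / 2 - s - 1) v)) = false)
      ≤ (1 + ε) * ((w : ℝ) / n) * totalInfl f := by
  subst hεt
  have hn : 0 < n := by
    rcases Nat.eq_zero_or_pos n with h | h
    · subst h
      simp [totalInfl] at hI
      linarith
    · exact h
  have hn' : (0 : ℝ) < n := by exact_mod_cast hn
  obtain ⟨hδ, hwδ, hww, hexp⟩ := params n w hn (totalInfl f) ε s hε0 hε1 hI (totalInfl_le hmono)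
    hεn hs hw2
  have hs0 : 0 ≤ s := by rw [hs]; positivity
  have hδ0 : 0 ≤ 2 * s / n := by positivity
  have hsd : s = n / 2 * (2 * s / n) := by field_simp
  set δ : ℝ := 2 * s / n with hδdef
  -- the cutoff
  obtain ⟨C, hC⟩ : ∃ C : ℕ, ⌈(n : ℝ) / 2 - s - 1⌉ = (C : ℤ) := by
    refine ⟨⌈(n : ℝ) / 2 - s - 1⌉.toNat, (Int.toNat_of_nonneg ?_).symm⟩
    have : (-1 : ℤ) < ⌈(n : ℝ) / 2 - s - 1⌉ := by
      rw [Int.lt_ceil]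
      push_cast
      nlinarith
    omega
  have hC1 : (n : ℝ) / 2 - s - 1 ≤ C := by
    have := Int.le_ceil ((n : ℝ) / 2 - s - 1)
    rw [hC] at this
    exact_mod_cast this
  have hC2 : (C : ℝ) < (n : ℝ) / 2 - s := by
    have := Int.ceil_lt_add_one ((n : ℝ) / 2 - s - 1)
    rw [hC] at this
    push_cast at this
    linarith
  rw [walkProb_eq hmono w C _ hC, sum_walk_edges]
  have hIeq : totalInfl f = 2 * (2 ^ n : ℝ)⁻¹ * ∑ k ∈ Finset.range n,
      ((k : ℝ) + 1) * (n.choose (k + 1) : ℝ) * (mu (fR f) (k + 1) - mu (fR f) k) := by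
    rw [totalInfl_eq hmono, abel]
  have hd0 : ∀ k ∈ Finset.range n, 0 ≤ mu (fR f) (k + 1) - mu (fR f) k := by
    intro k hk
    rw [Finset.mem_range] at hk
    have := mu_step hmono (m := k + 1) hk
    rw [Nat.add_sub_cancel] at this
    linarith
  have hd1 : ∀ k, mu (fR f) (k + 1) - mu (fR f) k ≤ 1 := by
    intro k
    have := mu_le_one f (k + 1)
    have := mu_nonneg f k
    linarith
  set d : ℕ → ℝ := fun k => mu (fR f) (k + 1) - mu (fR f) k with hd
  change (∀ k ∈ Finset.range n, 0 ≤ d k) at hd0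
  change (∀ k, d k ≤ 1) at hd1
  have h2n : (0 : ℝ) < (2 ^ n : ℝ)⁻¹ := by positivity
  constructor
  · -- lower bound
    set bad : ℕ → Prop := fun k => s < |((k + 1 : ℕ) : ℝ) - n / 2| with hbad
    classical
    have hbadsum : ∑ k ∈ (Finset.range n).filter bad,
        ((k : ℝ) + 1) * (n.choose (k + 1) : ℝ) * d k ≤ 2 ^ n * (ε / 4) := by
      calc _ ≤ ∑ k ∈ (Finset.range n).filter bad, (n : ℝ) * (n.choose (k + 1) : ℝ) := by
            refine Finset.sum_le_sum fun k hk => ?_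
            have hk' := (Finset.mem_filter.1 hk).1
            have h1 := hd1 k
            have h0 := hd0 k hk'
            rw [Finset.mem_range] at hk'
            have hkn : (k : ℝ) + 1 ≤ n := by exact_mod_cast hk'
            have : ((k : ℝ) + 1) * (n.choose (k + 1) : ℝ) ≤ n * (n.choose (k + 1) : ℝ) := by
              gcongr
            have h3 : (0 : ℝ) ≤ ((k : ℝ) + 1) * (n.choose (k + 1) : ℝ) := by positivity
            nlinarith
        _ = n * ∑ k ∈ (Finset.range n).filter bad, (n.choose (k + 1) : ℝ) := by
            rw [Finset.mul_sum]
        _ ≤ n * ∑ k ∈ (Finset.range (n + 1)).filter (fun k : ℕ => s < |(k : ℝ) - n / 2|),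
              (n.choose k : ℝ) := by
            refine mul_le_mul_of_nonneg_left ?_ hn'.le
            have hm : ∑ k ∈ (Finset.range n).filter bad, (n.choose (k + 1) : ℝ) =
                ∑ k ∈ ((Finset.range n).filter bad).map (addRightEmbedding 1),
                  (n.choose k : ℝ) := by
              rw [Finset.sum_map]; rfl
            rw [hm]
            refine Finset.sum_le_sum_of_subset_of_nonneg ?_ fun k _ _ => by positivity
            intro j hj
            rw [Finset.mem_map] at hj
            obtain ⟨k, hk, rfl⟩ := hj
            rw [Finset.mem_filter, Finset.mem_range] at hk ⊢
            refine ⟨?_, hk.2⟩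
            simp only [addRightEmbedding_apply]
            omega
        _ ≤ n * (2 * 2 ^ n * Real.exp (-(2 * s ^ 2 / n))) := by
            refine mul_le_mul_of_nonneg_left (tail_bound n hn s hs0) hn'.le
        _ = _ := by
            rw [hexp]; field_simp; norm_num
    have hsplit := Finset.sum_filter_add_sum_filter_not (Finset.range n) bad
      (fun k => ((k : ℝ) + 1) * (n.choose (k + 1) : ℝ) * d k)
    set A := ∑ k ∈ Finset.range n, ((k : ℝ) + 1) * (n.choose (k + 1) : ℝ) * d k with hA
    set G := ∑ k ∈ (Finset.range n).filter (fun k => ¬ bad k),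
      ((k : ℝ) + 1) * (n.choose (k + 1) : ℝ) * d k with hG
    have hlow : (1 - ε / 2) * (2 * w / n) * G ≤
        ∑ k ∈ Finset.range n, (if C ≤ k then ∑ t ∈ Finset.range w,
          (n.choose (k + 1 + t) : ℝ) else 0) * d k := by
      refine le_trans ?_ (Finset.sum_le_sum_of_subset_of_nonneg
        (Finset.filter_subset (fun k => ¬ bad k) _) fun k hk _ => ?_)
      · rw [hG, Finset.mul_sum]
        refine Finset.sum_le_sum fun k hk => ?_
        rw [Finset.mem_filter] at hk
        have hk2 : |((k + 1 : ℕ) : ℝ) - n / 2| ≤ s := not_lt.1 hk.2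
        rw [abs_le] at hk2
        have hCk : C ≤ k := by
          have : (C : ℝ) < ((k + 1 : ℕ) : ℝ) := by linarith
          have : C < k + 1 := by exact_mod_cast this
          omega
        rw [if_pos hCk, ← mul_assoc]
        refine mul_le_mul_of_nonneg_right ?_ (hd0 k hk.1)
        have := edge_lo n (k + 1) w hn ε δ hε0 hε1 hδ0 hδ hwδ hw1 hww (by linarith)
        push_cast at this
        exact this
      · refine mul_nonneg ?_ (hd0 k hk)
        split_ifs
        · exact Finset.sum_nonneg fun _ _ => by positivity
        · exact le_rfl
    have hGlow : (1 - ε / 2) * totalInfl f ≤ 2 * (2 ^ n : ℝ)⁻¹ * G := by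
      have h1 : 2 * (2 ^ n : ℝ)⁻¹ * (2 ^ n * (ε / 4)) = ε / 2 := by
        field_simp; norm_num
      have h2 : 2 * (2 ^ n : ℝ)⁻¹ * (A - G) ≤ ε / 2 := by
        rw [← h1]
        refine mul_le_mul_of_nonneg_left ?_ (by positivity)
        linarith
      have h3 : 2 * (2 ^ n : ℝ)⁻¹ * A = totalInfl f := hIeq.symm
      nlinarith
    calc (1 - ε) * ((w : ℝ) / n) * totalInfl f
        ≤ (1 - ε / 2) * ((w : ℝ) / n) * ((1 - ε / 2) * totalInfl f) := by
          have h1 : 0 ≤ (w : ℝ) / n * totalInfl f := by positivity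
          have h2 : 0 ≤ ε ^ 2 / 4 * ((w : ℝ) / n * totalInfl f) := by positivity
          linarith
      _ ≤ (1 - ε / 2) * ((w : ℝ) / n) * (2 * (2 ^ n : ℝ)⁻¹ * G) := by
          refine mul_le_mul_of_nonneg_left hGlow (mul_nonneg (by linarith) (by positivity))
      _ = (2 ^ n : ℝ)⁻¹ * ((1 - ε / 2) * (2 * w / n) * G) := by ring
      _ ≤ _ := mul_le_mul_of_nonneg_left hlow h2n.le
  · -- upper bound
    rw [hIeq]
    have hup : ∑ k ∈ Finset.range n, (if C ≤ k then ∑ t ∈ Finset.range w,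
          (n.choose (k + 1 + t) : ℝ) else 0) * d k ≤
        (1 + ε) * (2 * w / n) *
          ∑ k ∈ Finset.range n, ((k : ℝ) + 1) * (n.choose (k + 1) : ℝ) * d k := by
      rw [Finset.mul_sum]
      refine Finset.sum_le_sum fun k hk => ?_
      rw [← mul_assoc]
      refine mul_le_mul_of_nonneg_right ?_ (hd0 k hk)
      by_cases hCk : C ≤ k
      · rw [if_pos hCk]
        have hCk' : (C : ℝ) ≤ k := by exact_mod_cast hCk
        have := edge_up n (k + 1) w hn ε δ hε0 hε1 hδ0 hδ hwδ (by push_cast; linarith)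
        push_cast at this
        exact this
      · rw [if_neg hCk]
        positivity
    calc _ ≤ (2 ^ n : ℝ)⁻¹ * ((1 + ε) * (2 * w / n) *
          ∑ k ∈ Finset.range n, ((k : ℝ) + 1) * (n.choose (k + 1) : ℝ) * d k) :=
          mul_le_mul_of_nonneg_left hup h2n.le
      _ = _ := by ring
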